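/- For every integer n ≥ 1, the row vector Y_{−n} := ( √(F_n(F_n+G_n)⁻¹) , −√(G_n(F_n+G_n)⁻¹)·𝔖ⁿ ) with entries in B(H ⊕ H) satisfies Y_{−n} Y_{−n}* = 1 ⊕ SⁿS*ⁿ (the operator E_{−n} on H ⊕ H) and Y_{−n}* Y_{−n} = Q_{−n}, where Q_{−n} is the 2×2 operator matrix with entries (Q_{−n})₁₁ = F_n(F_n+G_n)⁻¹, (Q_{−n})₁₂ = −√(F_nG_n)(F_n+G_n)⁻¹𝔖ⁿ, (Q_{−n})₂₁ = −√(f_n(ζ)g_n(ζ))(f_n(ζ)+g_n(ζ))⁻¹𝔖*ⁿ, (Q_{−n})₂₂ = g_n(ζ)(f_n(ζ)+g_n(ζ))⁻¹. In particular the projections E_{−n} and Q_{−n} are Murray–von Neumann equivalent. -/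

import Mathlib

set_option synthInstance.maxHeartbeats 1000000
set_option maxHeartbeats 1000000

section Diagonal

open scoped ComplexInnerProductSpace ComplexOrder

variable {K : Type*} [NormedAddCommGroup K] [InnerProductSpace ℂ K] {ι : Type*}

/-- `T` acts on the family `e` as the diagonal operator with real eigenvalues `d`. -/
def IsDiag (e : ι → K) (T : K →L[ℂ] K) (d : ι → ℝ) : Prop :=
  ∀ p, T (e p) = ((d p : ℝ) : ℂ) • e p

theorem clm_ext_of_total {e : ι → K}
    (ht : (Submodule.span ℂ (Set.range e)).topologicalClosure = ⊤)
    {T R : K →L[ℂ] K} (h : ∀ p, T (e p) = R (e p)) : T = R := by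
  refine ContinuousLinearMap.ext_on (s := Set.range e) ?_ ?_
  · rw [← Submodule.dense_iff_topologicalClosure_eq_top] at ht
    exact ht
  · rintro _ ⟨p, rfl⟩
    exact h p

theorem eq_of_inner_total {e : ι → K}
    (ht : (Submodule.span ℂ (Set.range e)).topologicalClosure = ⊤)
    {x y : K} (h : ∀ p, ⟪e p, x⟫ = ⟪e p, y⟫) : x = y := by
  have : innerSL ℂ (x - y) = 0 := by
    rw [← Submodule.dense_iff_topologicalClosure_eq_top] at ht
    refine ContinuousLinearMap.ext_on (s := Set.range e) ht ?_
    rintro _ ⟨p, rfl⟩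
    have h2 : ⟪e p, x - y⟫ = 0 := by rw [inner_sub_right, h p, sub_self]
    rw [innerSL_apply_apply, inner_eq_zero_symm.1 h2, zero_apply]
  have h3 := congrArg (fun f => f (x - y)) this
  rw [innerSL_apply_apply, zero_apply, inner_self_eq_zero] at h3
  exact sub_eq_zero.1 h3

namespace IsDiag

variable {e : ι → K} {T R : K →L[ℂ] K} {d d' : ι → ℝ}

theorem one : IsDiag e (1 : K →L[ℂ] K) (fun _ => 1) := fun p => by simp

theorem smul (h : IsDiag e T d) (c : ℝ) : IsDiag e ((c : ℂ) • T) (fun p => c * d p) := fun p => by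
  rw [smul_apply, h p, smul_smul, Complex.ofReal_mul]

theorem add (h : IsDiag e T d) (h' : IsDiag e R d') : IsDiag e (T + R) (fun p => d p + d' p) :=
  fun p => by simp [h p, h' p, add_smul]

theorem sub (h : IsDiag e T d) (h' : IsDiag e R d') : IsDiag e (T - R) (fun p => d p - d' p) :=
  fun p => by simp [h p, h' p, sub_smul]

theorem mul (h : IsDiag e T d) (h' : IsDiag e R d') : IsDiag e (T * R) (fun p => d p * d' p) :=
  fun p => by
    rw [mul_apply_eq_comp, h' p, map_smul, h p, smul_smul, Complex.ofReal_mul, mul_comm]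

theorem list_prod {κ : Type*} {T : κ → K →L[ℂ] K} {d : κ → ι → ℝ} (h : ∀ k, IsDiag e (T k) (d k))
    (L : List κ) : IsDiag e (L.map T).prod (fun p => (L.map fun k => d k p).prod) := by
  induction L with
  | nil => simpa using one
  | cons a L ih => simpa using (h a).mul ih

variable [CompleteSpace K]

theorem star_eq (h : IsDiag e T d) (he : Orthonormal ℂ e)
    (ht : (Submodule.span ℂ (Set.range e)).topologicalClosure = ⊤) : star T = T := by
  classical
  refine clm_ext_of_total ht fun p => eq_of_inner_total ht fun r => ?_
  rw [ContinuousLinearMap.star_eq_adjoint, ContinuousLinearMap.adjoint_inner_right, h p, h r,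
    inner_smul_left, inner_smul_right, orthonormal_iff_ite.1 he]
  split_ifs with hpr
  · simp [hpr]
  · simp

theorem nonneg (h : IsDiag e T d) (he : Orthonormal ℂ e)
    (ht : (Submodule.span ℂ (Set.range e)).topologicalClosure = ⊤) (hd : ∀ p, 0 ≤ d p) :
    0 ≤ T := by
  have hs := h.star_eq he ht
  rw [ContinuousLinearMap.nonneg_iff_isPositive, ContinuousLinearMap.isPositive_iff_complex]
  intro x
  let b := HilbertBasis.mk he ht.ge
  have hb : ∀ p, b p = e p := fun p => by simp [b]
  have hsum := b.hasSum_inner_mul_inner (T x) x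
  have hterm : ∀ p, ⟪T x, b p⟫ * ⟪b p, x⟫ = ((d p * ‖⟪e p, x⟫‖ ^ 2 : ℝ) : ℂ) := by
    intro p
    rw [hb, ← ContinuousLinearMap.adjoint_inner_right, ← ContinuousLinearMap.star_eq_adjoint, hs,
      h p, inner_smul_right, mul_assoc, ← inner_conj_symm x (e p), Complex.conj_mul']
    push_cast
    rfl
  simp only [hterm] at hsum
  have h0 : 0 ≤ ⟪T x, x⟫ := hsum.nonneg fun p => by
    exact_mod_cast mul_nonneg (hd p) (sq_nonneg _)
  rw [Complex.nonneg_iff] at h0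
  exact ⟨Complex.ext rfl h0.2, h0.1⟩

theorem sqrt (h : IsDiag e T d) (he : Orthonormal ℂ e)
    (ht : (Submodule.span ℂ (Set.range e)).topologicalClosure = ⊤) (hd : ∀ p, 0 ≤ d p) :
    IsDiag e (CFC.sqrt T) (fun p => √(d p)) := by
  intro p
  have hT := h.nonneg he ht hd
  have hR : 0 ≤ CFC.sqrt T := CFC.sqrt_nonneg T
  have hRR : ∀ x, CFC.sqrt T (CFC.sqrt T x) = T x := fun x =>
    congrArg (fun f : K →L[ℂ] K => f x) (CFC.sqrt_mul_sqrt_self T hT)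
  set R := CFC.sqrt T
  rw [ContinuousLinearMap.nonneg_iff_isPositive] at hR
  rcases (hd p).eq_or_lt with h0 | h0
  · have h1 : ⟪R (e p), R (e p)⟫ = 0 := by
      rw [hR.isSymmetric.apply_clm, hRR, h p, ← h0]
      simp
    simpa [← h0] using h1
  · rw [← sub_eq_zero]
    set c := √(d p)
    have hc : 0 < c := Real.sqrt_pos.2 h0
    have hcc : c * c = d p := Real.mul_self_sqrt h0.le
    set v := R (e p) - (c : ℂ) • e p with hv
    have h1 : R v = -((c : ℂ) • v) := by
      rw [hv, map_sub, hRR, map_smul, h p, ← hcc, smul_sub, smul_smul]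
      push_cast
      abel
    have h2 := hR.re_inner_nonneg_left v
    rw [h1, inner_neg_left, inner_smul_left, inner_self_eq_norm_sq_to_K] at h2
    have h3 : c * ‖v‖ ^ 2 ≤ 0 := by
      have : (-((starRingEnd ℂ) (c : ℂ) * ((‖v‖ : ℝ) : ℂ) ^ 2)) = ((-(c * ‖v‖ ^ 2) : ℝ) : ℂ) := by
        simp
      have h4 : 0 ≤ (((-(c * ‖v‖ ^ 2) : ℝ) : ℂ)).re := by rw [← this]; exact h2
      rw [Complex.ofReal_re] at h4
      linarith
    have h4 : ‖v‖ ^ 2 ≤ 0 := by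
      by_contra hcon
      have := mul_pos hc (not_le.1 hcon)
      linarith
    have h5 : ‖v‖ = 0 := by nlinarith [norm_nonneg v]
    exact norm_eq_zero.1 h5

theorem ringInverse (h : IsDiag e T d) (he : Orthonormal ℂ e)
    (ht : (Submodule.span ℂ (Set.range e)).topologicalClosure = ⊤) {c : ℝ} (hc : 0 < c)
    (hd : ∀ p, c ≤ d p) : IsDiag e (Ring.inverse T) (fun p => (d p)⁻¹) := by
  have hu : IsUnit T := by
    have h1 : ((c : ℂ) • (1 : K →L[ℂ] K)) ≤ T := by
      rw [← sub_nonneg]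
      exact (h.sub (one.smul c)).nonneg he ht fun p => by simpa using hd p
    have h2 : IsStrictlyPositive ((c : ℂ) • (1 : K →L[ℂ] K)) := by
      refine IsStrictlyPositive.smul (by exact_mod_cast hc) ?_
      exact isStrictlyPositive_one
    exact CStarAlgebra.isUnit_of_le _ h1 h2
  intro p
  have h1 : Ring.inverse T (T (e p)) = e p :=
    congrArg (fun f : K →L[ℂ] K => f (e p)) (Ring.inverse_mul_cancel T hu)
  have hdp : (d p : ℂ) ≠ 0 := by exact_mod_cast (hc.trans_le (hd p)).ne'
  rw [h p, map_smul] at h1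
  rw [Complex.ofReal_inv]
  exact (inv_smul_eq_iff₀ hdp).2 h1.symm |>.symm

end IsDiag

end Diagonal

section Shift

open scoped ComplexInnerProductSpace

variable {K : Type*} [NormedAddCommGroup K] [InnerProductSpace ℂ K]
  {e : Bool × ℕ → K} {V : K →L[ℂ] K}

theorem shift_pow_apply (hV : ∀ (i : Bool) (m : ℕ), V (e (i, m)) = e (i, m + 1))
    (n : ℕ) (i : Bool) (m : ℕ) : (V ^ n) (e (i, m)) = e (i, m + n) := by
  induction n with
  | zero => simp
  | succ n ih => rw [pow_succ', mul_apply_eq_comp, ih, hV, add_assoc]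

theorem star_shift_pow_apply [CompleteSpace K] (he : Orthonormal ℂ e)
    (ht : (Submodule.span ℂ (Set.range e)).topologicalClosure = ⊤)
    (hV : ∀ (i : Bool) (m : ℕ), V (e (i, m)) = e (i, m + 1)) (n : ℕ) (i : Bool) (m : ℕ) :
    (star (V ^ n)) (e (i, m)) = if m < n then 0 else e (i, m - n) := by
  refine eq_of_inner_total ht fun ⟨j, l⟩ => ?_
  rw [ContinuousLinearMap.star_eq_adjoint, ContinuousLinearMap.adjoint_inner_right,
    shift_pow_apply hV, orthonormal_iff_ite.1 he]
  split_ifs with h1 h2 h2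
  · simp only [Prod.mk.injEq] at h1
    omega
  · simp only [Prod.mk.injEq] at h1
    obtain ⟨rfl, h1⟩ := h1
    have h3 : l = m - n := by omega
    rw [orthonormal_iff_ite.1 he, h3, if_pos rfl]
  · simp
  · rw [orthonormal_iff_ite.1 he, if_neg]
    simp only [Prod.mk.injEq] at h1 ⊢
    rintro ⟨rfl, rfl⟩
    exact h1 ⟨rfl, by omega⟩

end Shift

section Eigenvalues

/-- The eigenvalues of `ζ = Z₋ ⊕ Z₊`. -/
noncomputable def zetaEigenvalue (q s : ℝ) (p : Bool × ℕ) : ℝ :=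
  if p.1 then q ^ (2 * (p.2 + 1)) else -(s ^ 2 * q ^ (2 * (p.2 + 1)))

/-- The eigenvalues of `f_n(ζ)`. -/
noncomputable def fEigenvalue (q s : ℝ) (n : ℕ) (p : Bool × ℕ) : ℝ :=
  ((List.range n).map fun k => 1 - q ^ (2 * k) * zetaEigenvalue q s p).prod

/-- The eigenvalues of `g_n(ζ)`. -/
noncomputable def gEigenvalue (q s : ℝ) (n : ℕ) (p : Bool × ℕ) : ℝ :=
  ((List.range n).map fun k => s ^ 2 * 1 + q ^ (2 * k) * zetaEigenvalue q s p).prod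

/-- The eigenvalues of `F_n`. -/
noncomputable def shiftedFEigenvalue (q s : ℝ) (n : ℕ) (p : Bool × ℕ) : ℝ :=
  ((List.range n).map fun k : ℕ =>
    1 - q ^ (2 * (k : ℤ) - 2 * (n : ℤ)) * zetaEigenvalue q s p).prod

/-- The eigenvalues of `G_n`. -/
noncomputable def shiftedGEigenvalue (q s : ℝ) (n : ℕ) (p : Bool × ℕ) : ℝ :=
  ((List.range n).map fun k : ℕ =>
    s ^ 2 * 1 + q ^ (2 * (k : ℤ) - 2 * (n : ℤ)) * zetaEigenvalue q s p).prod

variable {q s : ℝ} {n : ℕ}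

theorem list_bind_pure_natCast (L : List ℕ) :
    (do let a ← L; pure (a : ℤ)) = L.map fun k : ℕ => (k : ℤ) :=
  (List.map_eq_flatMap ..).symm

theorem list_map_prod_nonneg {κ : Type*} (L : List κ) (f : κ → ℝ) (h : ∀ k ∈ L, 0 ≤ f k) :
    0 ≤ (L.map f).prod :=
  List.prod_nonneg (by simpa using h)

theorem pow_le_list_range_prod {c : ℝ} (hc : 0 ≤ c) (f : ℕ → ℝ) (h : ∀ k, c ≤ f k) (n : ℕ) :
    c ^ n ≤ ((List.range n).map f).prod := by
  induction n with
  | zero => simp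
  | succ n ih =>
    rw [List.range_succ, List.map_append, List.prod_append, pow_succ]
    simpa using mul_le_mul ih (h n) hc ((pow_nonneg hc n).trans ih)

theorem zpow_mul_pow_even (hq : 0 < q) (k n m : ℕ) :
    q ^ (2 * (k : ℤ) - 2 * (n : ℤ)) * q ^ (2 * (m + 1)) =
      q ^ (2 * ((k : ℤ) - n + m + 1)) := by
  rw [← zpow_natCast, ← zpow_add₀ hq.ne']
  congr 1
  push_cast
  ring

theorem shifted_mul_zetaEigenvalue (hq : 0 < q) (k : ℕ) (i : Bool) (m : ℕ) :
    q ^ (2 * (k : ℤ) - 2 * (n : ℤ)) * zetaEigenvalue q s (i, m + n) =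
      q ^ (2 * k) * zetaEigenvalue q s (i, m) := by
  have h : q ^ (2 * (k : ℤ) - 2 * (n : ℤ)) * q ^ (2 * (m + n + 1)) =
      q ^ (2 * k) * q ^ (2 * (m + 1)) := by
    rw [zpow_mul_pow_even hq, ← pow_add, ← zpow_natCast]
    congr 1
    push_cast
    ring
  cases i
  · simp only [zetaEigenvalue, Bool.false_eq_true, if_false]
    linear_combination (-s ^ 2) * h
  · simpa only [zetaEigenvalue, if_true] using h

theorem shiftedFEigenvalue_add (hq : 0 < q) (i : Bool) (m : ℕ) :
    shiftedFEigenvalue q s n (i, m + n) = fEigenvalue q s n (i, m) := by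
  simp only [shiftedFEigenvalue, fEigenvalue, shifted_mul_zetaEigenvalue hq]

theorem shiftedGEigenvalue_add (hq : 0 < q) (i : Bool) (m : ℕ) :
    shiftedGEigenvalue q s n (i, m + n) = gEigenvalue q s n (i, m) := by
  simp only [shiftedGEigenvalue, gEigenvalue, shifted_mul_zetaEigenvalue hq]

theorem shiftedFEigenvalue_true_eq_zero (hq : 0 < q) {m : ℕ} (hm : m < n) :
    shiftedFEigenvalue q s n (true, m) = 0 := by
  refine List.prod_eq_zero (List.mem_map.2 ⟨n - 1 - m, List.mem_range.2 (by omega), ?_⟩)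
  have h : ((n - 1 - m : ℕ) : ℤ) - n + m + 1 = 0 := by omega
  simp only [zetaEigenvalue, if_true]
  rw [zpow_mul_pow_even hq, h]
  simp

theorem shiftedGEigenvalue_false_eq_zero (hq : 0 < q) {m : ℕ} (hm : m < n) :
    shiftedGEigenvalue q s n (false, m) = 0 := by
  refine List.prod_eq_zero (List.mem_map.2 ⟨n - 1 - m, List.mem_range.2 (by omega), ?_⟩)
  have h : ((n - 1 - m : ℕ) : ℤ) - n + m + 1 = 0 := by omega
  simp only [zetaEigenvalue, Bool.false_eq_true, if_false]
  rw [mul_neg, mul_left_comm, zpow_mul_pow_even hq, h]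
  simp

theorem fEigenvalue_nonneg (hq0 : 0 < q) (hq1 : q < 1) (p : Bool × ℕ) :
    0 ≤ fEigenvalue q s n p := by
  obtain ⟨_ | _, m⟩ := p
  all_goals
    refine list_map_prod_nonneg _ _ fun k _ => ?_
    have h1 : 0 < q ^ (2 * k) := pow_pos hq0 _
    have h2 : q ^ (2 * k) * q ^ (2 * (m + 1)) ≤ 1 :=
      mul_le_one₀ (pow_le_one₀ hq0.le hq1.le) (by positivity) (pow_le_one₀ hq0.le hq1.le)
    simp only [zetaEigenvalue, Bool.false_eq_true, if_false, if_true]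
  · rw [mul_neg, sub_neg_eq_add]
    positivity
  · linarith

theorem gEigenvalue_nonneg (hq0 : 0 < q) (hq1 : q < 1) (p : Bool × ℕ) :
    0 ≤ gEigenvalue q s n p := by
  obtain ⟨_ | _, m⟩ := p
  all_goals
    refine list_map_prod_nonneg _ _ fun k _ => ?_
    have h1 : 0 < q ^ (2 * k) := pow_pos hq0 _
    have h2 : q ^ (2 * k) * q ^ (2 * (m + 1)) ≤ 1 :=
      mul_le_one₀ (pow_le_one₀ hq0.le hq1.le) (by positivity) (pow_le_one₀ hq0.le hq1.le)
    simp only [zetaEigenvalue, Bool.false_eq_true, if_false, if_true]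
  · nlinarith [mul_nonneg (sq_nonneg s) (sub_nonneg.2 h2)]
  · positivity

theorem one_le_fEigenvalue_false (hq : 0 < q) (m : ℕ) : 1 ≤ fEigenvalue q s n (false, m) := by
  rw [← one_pow n]
  refine pow_le_list_range_prod zero_le_one _ (fun k => ?_) n
  simp only [zetaEigenvalue, Bool.false_eq_true, if_false]
  rw [mul_neg, sub_neg_eq_add]
  exact le_add_of_nonneg_right (by positivity)

theorem one_le_shiftedFEigenvalue_false (hq : 0 < q) (m : ℕ) :
    1 ≤ shiftedFEigenvalue q s n (false, m) := by
  rw [← one_pow n]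
  refine pow_le_list_range_prod zero_le_one _ (fun k => ?_) n
  simp only [zetaEigenvalue, Bool.false_eq_true, if_false]
  rw [mul_neg, sub_neg_eq_add]
  exact le_add_of_nonneg_right (by positivity)

theorem pow_le_gEigenvalue_true (hq : 0 < q) (m : ℕ) :
    (s ^ 2) ^ n ≤ gEigenvalue q s n (true, m) := by
  refine pow_le_list_range_prod (sq_nonneg s) _ (fun k => ?_) n
  simp only [zetaEigenvalue, if_true, mul_one]
  exact le_add_of_nonneg_right (by positivity)

theorem pow_le_shiftedGEigenvalue_true (hq : 0 < q) (m : ℕ) :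
    (s ^ 2) ^ n ≤ shiftedGEigenvalue q s n (true, m) := by
  refine pow_le_list_range_prod (sq_nonneg s) _ (fun k => ?_) n
  simp only [zetaEigenvalue, if_true, mul_one]
  exact le_add_of_nonneg_right (by positivity)

theorem shiftedFEigenvalue_nonneg (hq0 : 0 < q) (hq1 : q < 1) (p : Bool × ℕ) :
    0 ≤ shiftedFEigenvalue q s n p := by
  obtain ⟨i, m⟩ := p
  rcases lt_or_ge m n with hm | hm
  · cases i
    · exact zero_le_one.trans (one_le_shiftedFEigenvalue_false hq0 m)
    · exact (shiftedFEigenvalue_true_eq_zero hq0 hm).ge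
  · obtain ⟨l, rfl⟩ := Nat.exists_eq_add_of_le' hm
    rw [shiftedFEigenvalue_add hq0]
    exact fEigenvalue_nonneg hq0 hq1 _

theorem shiftedGEigenvalue_nonneg (hq0 : 0 < q) (hq1 : q < 1) (p : Bool × ℕ) :
    0 ≤ shiftedGEigenvalue q s n p := by
  obtain ⟨i, m⟩ := p
  rcases lt_or_ge m n with hm | hm
  · cases i
    · exact (shiftedGEigenvalue_false_eq_zero hq0 hm).ge
    · exact (by positivity : (0 : ℝ) ≤ (s ^ 2) ^ n).trans (pow_le_shiftedGEigenvalue_true hq0 m)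
  · obtain ⟨l, rfl⟩ := Nat.exists_eq_add_of_le' hm
    rw [shiftedGEigenvalue_add hq0]
    exact gEigenvalue_nonneg hq0 hq1 _

theorem min_le_fEigenvalue_add_gEigenvalue (hq0 : 0 < q) (hq1 : q < 1) (p : Bool × ℕ) :
    min 1 ((s ^ 2) ^ n) ≤ fEigenvalue q s n p + gEigenvalue q s n p := by
  have hf := fEigenvalue_nonneg (s := s) (n := n) hq0 hq1 p
  have hg := gEigenvalue_nonneg (s := s) (n := n) hq0 hq1 p
  obtain ⟨_ | _, m⟩ := p
  · exact (min_le_left _ _).trans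
      ((one_le_fEigenvalue_false hq0 m).trans (le_add_of_nonneg_right hg))
  · exact (min_le_right _ _).trans
      ((pow_le_gEigenvalue_true hq0 m).trans (le_add_of_nonneg_left hf))

theorem min_le_shiftedFEigenvalue_add_shiftedGEigenvalue (hq0 : 0 < q) (hq1 : q < 1)
    (p : Bool × ℕ) :
    min 1 ((s ^ 2) ^ n) ≤ shiftedFEigenvalue q s n p + shiftedGEigenvalue q s n p := by
  have hf := shiftedFEigenvalue_nonneg (s := s) (n := n) hq0 hq1 p
  have hg := shiftedGEigenvalue_nonneg (s := s) (n := n) hq0 hq1 p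
  obtain ⟨_ | _, m⟩ := p
  · exact (min_le_left _ _).trans
      ((one_le_shiftedFEigenvalue_false hq0 m).trans (le_add_of_nonneg_right hg))
  · exact (min_le_right _ _).trans
      ((pow_le_shiftedGEigenvalue_true hq0 m).trans (le_add_of_nonneg_left hf))

theorem sqrt_mul_inv_mul_sqrt_mul_inv {a b c : ℝ} (ha : 0 ≤ a) (hc : 0 ≤ c) :
    √(a * c⁻¹) * √(b * c⁻¹) = √(a * b) * c⁻¹ := by
  rw [← Real.sqrt_mul (mul_nonneg ha (inv_nonneg.2 hc)),
    show a * c⁻¹ * (b * c⁻¹) = a * b * c⁻¹ ^ 2 by ring,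
    Real.sqrt_mul' _ (sq_nonneg _), Real.sqrt_sq (inv_nonneg.2 hc)]

end Eigenvalues

/-- On `K ≅ H ⊕ H` (total orthonormal family `e : Bool × ℕ → K`, minus copy `false`,
plus copy `true`), with `ζ = Z₋ ⊕ Z₊`, `𝔖 = S ⊕ S`:  the row vector
`Y_{−n} = ( √(F_n(F_n+G_n)⁻¹) , −√(G_n(F_n+G_n)⁻¹)·𝔖ⁿ )` satisfies
`Y_{−n} Y_{−n}* = E_{−n} = 1 ⊕ SⁿS*ⁿ` (identity on the first copy, `SⁿS*ⁿ` on the second)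
and `Y_{−n}* Y_{−n} = Q_{−n}`; in particular the projections `E_{−n}` and `Q_{−n}` are
Murray–von Neumann equivalent. -/
theorem stmt3
    (q s : ℝ) (hq0 : 0 < q) (hq1 : q < 1) (hs : 0 < s)
    {K : Type*} [NormedAddCommGroup K] [InnerProductSpace ℂ K] [CompleteSpace K]
    (e : Bool × ℕ → K) (he : Orthonormal ℂ e)
    (htotal : (Submodule.span ℂ (Set.range e)).topologicalClosure = ⊤)
    (ζ 𝔖 : K →L[ℂ] K)
    (hζm : ∀ m : ℕ, ζ (e (false, m)) = ((-(s ^ 2 * q ^ (2 * (m + 1))) : ℝ) : ℂ) • e (false, m))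
    (hζp : ∀ m : ℕ, ζ (e (true, m)) = ((q ^ (2 * (m + 1)) : ℝ) : ℂ) • e (true, m))
    (h𝔖 : ∀ (i : Bool) (m : ℕ), 𝔖 (e (i, m)) = e (i, m + 1))
    (n : ℕ) (hn : 1 ≤ n)
    (fn gn Fn Gn : K →L[ℂ] K)
    (hfn : fn = ((List.range n).map fun k => 1 - ((q ^ (2 * k) : ℝ) : ℂ) • ζ).prod)
    (hgn : gn = ((List.range n).map fun k => ((s ^ 2 : ℝ) : ℂ) • (1 : K →L[ℂ] K) + ((q ^ (2 * k) : ℝ) : ℂ) • ζ).prod)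
    (hFn : Fn = ((List.range n).map fun k => 1 - ((q ^ (2 * (k : ℤ) - 2 * (n : ℤ)) : ℝ) : ℂ) • ζ).prod)
    (hGn : Gn = ((List.range n).map fun k => ((s ^ 2 : ℝ) : ℂ) • (1 : K →L[ℂ] K) + ((q ^ (2 * (k : ℤ) - 2 * (n : ℤ)) : ℝ) : ℂ) • ζ).prod)
    (En' : K →L[ℂ] K)
    (hEm : ∀ m : ℕ, En' (e (false, m)) = e (false, m))
    (hEp : ∀ m : ℕ, En' (e (true, m)) = if m < n then 0 else e (true, m))
    (Q' : Matrix (Fin 2) (Fin 2) (K →L[ℂ] K))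
    (hQ' : Q' = !![Fn * Ring.inverse (Fn + Gn),
                 -(CFC.sqrt (Fn * Gn) * Ring.inverse (Fn + Gn) * 𝔖 ^ n);
                 -(CFC.sqrt (fn * gn) * Ring.inverse (fn + gn) * (star 𝔖) ^ n),
                 gn * Ring.inverse (fn + gn)])
    (Y : Matrix (Fin 1) (Fin 2) (K →L[ℂ] K))
    (hY : Y = !![CFC.sqrt (Fn * Ring.inverse (Fn + Gn)),
                 -(CFC.sqrt (Gn * Ring.inverse (Fn + Gn)) * 𝔖 ^ n)]) :
    Y * Y.conjTranspose = !![En'] ∧ Y.conjTranspose * Y = Q' := by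
  have hζ : IsDiag e ζ (zetaEigenvalue q s) := by
    rintro ⟨_ | _, m⟩
    · exact hζm m
    · exact hζp m
  have hf : IsDiag e fn (fEigenvalue q s n) :=
    hfn ▸ IsDiag.list_prod (fun k => IsDiag.one.sub (hζ.smul _)) _
  have hg : IsDiag e gn (gEigenvalue q s n) :=
    hgn ▸ IsDiag.list_prod (fun k => (IsDiag.one.smul _).add (hζ.smul _)) _
  rw [list_bind_pure_natCast, List.map_map] at hFn hGn
  have hF : IsDiag e Fn (shiftedFEigenvalue q s n) :=
    hFn ▸ IsDiag.list_prod (fun k => IsDiag.one.sub (hζ.smul _)) _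
  have hG : IsDiag e Gn (shiftedGEigenvalue q s n) :=
    hGn ▸ IsDiag.list_prod (fun k => (IsDiag.one.smul _).add (hζ.smul _)) _
  clear hfn hgn hFn hGn hn
  have hf0 := fEigenvalue_nonneg (s := s) (n := n) hq0 hq1
  have hg0 := gEigenvalue_nonneg (s := s) (n := n) hq0 hq1
  have hF0 := shiftedFEigenvalue_nonneg (s := s) (n := n) hq0 hq1
  have hG0 := shiftedGEigenvalue_nonneg (s := s) (n := n) hq0 hq1
  have hc : 0 < min 1 ((s ^ 2) ^ n) := lt_min one_pos (by positivity)
  have hfg := min_le_fEigenvalue_add_gEigenvalue (s := s) (n := n) hq0 hq1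
  have hFG := min_le_shiftedFEigenvalue_add_shiftedGEigenvalue (s := s) (n := n) hq0 hq1
  have hFs := shiftedFEigenvalue_add (s := s) (n := n) hq0
  have hGs := shiftedGEigenvalue_add (s := s) (n := n) hq0
  have hFz := fun m => shiftedFEigenvalue_true_eq_zero (s := s) (n := n) (m := m) hq0
  have hGz := fun m => shiftedGEigenvalue_false_eq_zero (s := s) (n := n) (m := m) hq0
  generalize fEigenvalue q s n = f at *
  generalize gEigenvalue q s n = g at *
  generalize shiftedFEigenvalue q s n = F at *
  generalize shiftedGEigenvalue q s n = G at *
  have hfgpos : ∀ p, 0 < f p + g p := fun p => hc.trans_le (hfg p)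
  have hFGpos : ∀ p, 0 < F p + G p := fun p => hc.trans_le (hFG p)
  have hinv := (hf.add hg).ringInverse he htotal hc hfg
  have hInv := (hF.add hG).ringInverse he htotal hc hFG
  have hA := (hF.mul hInv).sqrt he htotal
    fun p => mul_nonneg (hF0 p) (inv_nonneg.2 (hFGpos p).le)
  have hB := (hG.mul hInv).sqrt he htotal
    fun p => mul_nonneg (hG0 p) (inv_nonneg.2 (hFGpos p).le)
  have hC := ((hF.mul hG).sqrt he htotal fun p => mul_nonneg (hF0 p) (hG0 p)).mul hInv
  have hD := ((hf.mul hg).sqrt he htotal fun p => mul_nonneg (hf0 p) (hg0 p)).mul hinv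
  have hFI := hF.mul hInv
  have hgI := hg.mul hinv
  have hAs := hA.star_eq he htotal
  have hBs := hB.star_eq he htotal
  have hV := shift_pow_apply h𝔖 n
  have hW := star_shift_pow_apply he htotal h𝔖 n
  have hAA : ∀ p, √(F p * (F p + G p)⁻¹) * √(F p * (F p + G p)⁻¹) = F p * (F p + G p)⁻¹ :=
    fun p => Real.mul_self_sqrt (mul_nonneg (hF0 p) (inv_nonneg.2 (hFGpos p).le))
  have hBB : ∀ p, √(G p * (F p + G p)⁻¹) * √(G p * (F p + G p)⁻¹) = G p * (F p + G p)⁻¹ :=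
    fun p => Real.mul_self_sqrt (mul_nonneg (hG0 p) (inv_nonneg.2 (hFGpos p).le))
  have hAB : ∀ p, √(F p * (F p + G p)⁻¹) * √(G p * (F p + G p)⁻¹) =
      √(F p * G p) * (F p + G p)⁻¹ :=
    fun p => sqrt_mul_inv_mul_sqrt_mul_inv (hF0 p) (hFGpos p).le
  have hadd : ∀ p, F p * (F p + G p)⁻¹ + G p * (F p + G p)⁻¹ = 1 := fun p => by
    rw [← add_mul, mul_inv_cancel₀ (hFGpos p).ne']
  rw [← star_pow] at hQ'
  subst hY hQ'
  generalize CFC.sqrt (Fn * Ring.inverse (Fn + Gn)) = A at *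
  generalize CFC.sqrt (Gn * Ring.inverse (Fn + Gn)) = B at *
  generalize CFC.sqrt (Fn * Gn) * Ring.inverse (Fn + Gn) = C at *
  generalize CFC.sqrt (fn * gn) * Ring.inverse (fn + gn) = D at *
  generalize Fn * Ring.inverse (Fn + Gn) = M at *
  generalize gn * Ring.inverse (fn + gn) = N at *
  have hAAM : A * A = M := clm_ext_of_total htotal fun p => by
    rw [hA.mul hA p, hFI p]
    beta_reduce
    rw [hAA]
  have hABC : A * B = C := clm_ext_of_total htotal fun p => by
    rw [hA.mul hB p, hC p]
    beta_reduce
    rw [hAB]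
  have hBAC : B * A = C := clm_ext_of_total htotal fun p => by
    rw [hB.mul hA p, hC p]
    beta_reduce
    rw [← hAB, mul_comm]
  have hBBN : star (𝔖 ^ n) * (B * B) * 𝔖 ^ n = N := clm_ext_of_total htotal fun ⟨i, m⟩ => by
    rw [mul_apply_eq_comp, mul_apply_eq_comp, hV, hB.mul hB, map_smul, hW,
      if_neg (by omega), Nat.add_sub_cancel, hgI]
    beta_reduce
    rw [hBB, hFs, hGs]
  have hCD : star (𝔖 ^ n) * C = D * star (𝔖 ^ n) := clm_ext_of_total htotal fun ⟨i, m⟩ => by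
    rw [mul_apply_eq_comp, mul_apply_eq_comp, hC, map_smul, hW]
    split_ifs with hm
    · rw [smul_zero, map_zero]
    · obtain ⟨l, rfl⟩ := Nat.exists_eq_add_of_le' (not_lt.1 hm)
      rw [Nat.add_sub_cancel, hD]
      beta_reduce
      rw [hFs, hGs]
  have hE : A * A + B * (𝔖 ^ n * star (𝔖 ^ n)) * B = En' :=
    clm_ext_of_total htotal fun ⟨i, m⟩ => by
      rw [add_apply, hAAM, hFI, mul_apply_eq_comp, mul_apply_eq_comp, mul_apply_eq_comp, hB,
        map_smul, map_smul, map_smul, hW]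
      beta_reduce
      rcases lt_or_ge m n with hm | hm
      · rw [if_pos hm, map_zero, map_zero, smul_zero, add_zero]
        cases i
        · have := hadd (false, m)
          rw [hGz m hm, zero_mul, add_zero] at this
          rw [hEm, hGz m hm, this, Complex.ofReal_one, one_smul]
        · rw [hEp, if_pos hm, hFz m hm, zero_mul, Complex.ofReal_zero, zero_smul]
      · rw [if_neg (not_lt.2 hm), hV, Nat.sub_add_cancel hm, hB]
        beta_reduce
        rw [smul_smul, ← Complex.ofReal_mul,
          hBB, ← add_smul, ← Complex.ofReal_add, hadd, Complex.ofReal_one, one_smul]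
        cases i
        · rw [hEm]
        · rw [hEp, if_neg (not_lt.2 hm)]
  constructor
  · ext1 i j
    fin_cases i; fin_cases j
    simp [Matrix.mul_apply, Fin.sum_univ_two, Matrix.conjTranspose_apply, hAs, hBs, ← hE, mul_assoc]
  · ext1 i j
    fin_cases i <;> fin_cases j
    · simp [Matrix.mul_apply, hAs, hAAM]
    · simp [Matrix.mul_apply, hAs, ← hABC, mul_assoc]
    · rw [← hBAC, star_pow] at hCD
      simp [Matrix.mul_apply, hBs, ← hCD, mul_assoc]
    · simp [Matrix.mul_apply, hBs, ← hBBN, mul_assoc]
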